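/- arXiv:2502.18103 — 3 statements merged into one kernel-verified Lean document; each statement's English description precedes it below -/
import Mathlib

section
/- For every real a > 0, every real q ≥ 1, and every Borel measurable function v : Ω_n → [0,∞], the change-of-variables identity ∫_{Ω_γ} v(ψ_a(x))^q · w_{γ,a}(x) dx = ∫_{Ω_n} v(y)^q dy holds (as an equality of Lebesgue integrals with values in [0,∞]). -/
open MeasureTheory Real Filter Topology
open scoped ENNReal

noncomputable section

/-- The last coordinate `x_n` of a point in `ℝ^n` (junk value `0` if `n = 0`). -/
def lastCoord {n : ℕ} (x : EuclideanSpace ℝ (Fin n)) : ℝ :=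
  if h : 0 < n then x ⟨n - 1, Nat.sub_lt h Nat.one_pos⟩ else 0

/-- The outward cuspidal domain
`Ω_γ = {x : 0 < x_n < 1, 0 < x_i < x_n ^ σ for i = 1, …, n-1}` (with `σ = (γ-1)/(n-1)`). -/
def cuspDomain (n : ℕ) (σ : ℝ) : Set (EuclideanSpace ℝ (Fin n)) :=
  {x | 0 < lastCoord x ∧ lastCoord x < 1 ∧
    ∀ i : Fin n, (i : ℕ) + 1 ≠ n → 0 < x i ∧ x i < lastCoord x ^ σ}

/-- The model simplex `Ω_n = {y : 0 < y_n < 1, 0 < y_i < y_n for i = 1, …, n-1}`. -/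
def simplexDomain (n : ℕ) : Set (EuclideanSpace ℝ (Fin n)) := cuspDomain n 1

/-- The map `φ_a(y) = (y_1 y_n^{aσ-1}, …, y_{n-1} y_n^{aσ-1}, y_n^a)`. -/
def phiMap (n : ℕ) (σ a : ℝ) (y : EuclideanSpace ℝ (Fin n)) : EuclideanSpace ℝ (Fin n) :=
  WithLp.toLp 2 fun i => if (i : ℕ) + 1 = n then lastCoord y ^ a else y i * lastCoord y ^ (a * σ - 1)

/-- The map `ψ_a(x) = (x_1 x_n^{1/a-σ}, …, x_{n-1} x_n^{1/a-σ}, x_n^{1/a})`. -/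
def psiMap (n : ℕ) (σ a : ℝ) (x : EuclideanSpace ℝ (Fin n)) : EuclideanSpace ℝ (Fin n) :=
  WithLp.toLp 2 fun i => if (i : ℕ) + 1 = n then lastCoord x ^ (1 / a) else x i * lastCoord x ^ (1 / a - σ)

/-- The weight `w_{γ,a}(x) = (1/a) x_n^{n/a - γ}`. -/
def weightA (n : ℕ) (γ a : ℝ) (x : EuclideanSpace ℝ (Fin n)) : ℝ :=
  (1 / a) * lastCoord x ^ ((n : ℝ) / a - γ)

/-- The weight `w_γ(x) = ((γ-p)/(n-p)) x_n^{p(γ-n)/(n-p)}`. -/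
def weightG (n : ℕ) (γ p : ℝ) (x : EuclideanSpace ℝ (Fin n)) : ℝ :=
  ((γ - p) / ((n : ℝ) - p)) * lastCoord x ^ (p * (γ - (n : ℝ)) / ((n : ℝ) - p))

theorem lastCoord_succ {m : ℕ} (x : EuclideanSpace ℝ (Fin (m + 1))) :
    lastCoord x = x (Fin.last m) := by
  simp only [lastCoord, Nat.succ_pos, dite_true]
  rfl

theorem succ_eq_iff {m : ℕ} (i : Fin (m + 1)) : (i : ℕ) + 1 = m + 1 ↔ i = Fin.last m := by
  rw [Fin.ext_iff, Fin.val_last]; omega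

theorem psi_last {m : ℕ} (σ a : ℝ) (x : EuclideanSpace ℝ (Fin (m + 1))) :
    psiMap (m + 1) σ a x (Fin.last m) = x (Fin.last m) ^ (1 / a) := by
  simp [psiMap, lastCoord_succ]

theorem psi_ne {m : ℕ} (σ a : ℝ) (x : EuclideanSpace ℝ (Fin (m + 1))) {i : Fin (m + 1)}
    (hi : i ≠ Fin.last m) :
    psiMap (m + 1) σ a x i = x i * x (Fin.last m) ^ (1 / a - σ) := by
  have := mt (succ_eq_iff i).1 hi
  simp only [psiMap, lastCoord_succ, if_neg this]

theorem phi_last {m : ℕ} (σ a : ℝ) (x : EuclideanSpace ℝ (Fin (m + 1))) :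
    phiMap (m + 1) σ a x (Fin.last m) = x (Fin.last m) ^ a := by
  simp [phiMap, lastCoord_succ]

theorem phi_ne {m : ℕ} (σ a : ℝ) (x : EuclideanSpace ℝ (Fin (m + 1))) {i : Fin (m + 1)}
    (hi : i ≠ Fin.last m) :
    phiMap (m + 1) σ a x i = x i * x (Fin.last m) ^ (a * σ - 1) := by
  have := mt (succ_eq_iff i).1 hi
  simp only [phiMap, lastCoord_succ, if_neg this]

theorem mem_cusp {m : ℕ} {σ : ℝ} {x : EuclideanSpace ℝ (Fin (m + 1))} :
    x ∈ cuspDomain (m + 1) σ ↔ 0 < x (Fin.last m) ∧ x (Fin.last m) < 1 ∧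
      ∀ i, i ≠ Fin.last m → 0 < x i ∧ x i < x (Fin.last m) ^ σ := by
  simp only [cuspDomain, Set.mem_setOf_eq, lastCoord_succ, ne_eq, succ_eq_iff]

theorem phi_psi {m : ℕ} {σ a : ℝ} (ha : 0 < a) {x : EuclideanSpace ℝ (Fin (m + 1))}
    (hx : 0 < x (Fin.last m)) : phiMap (m + 1) σ a (psiMap (m + 1) σ a x) = x := by
  ext i
  by_cases hi : i = Fin.last m
  · subst hi
    rw [phi_last, psi_last, ← rpow_mul hx.le, one_div_mul_cancel ha.ne', rpow_one]
  · rw [phi_ne _ _ _ hi, psi_last, psi_ne _ _ _ hi, ← rpow_mul hx.le, mul_assoc,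
      ← rpow_add hx]
    have : 1 / a - σ + 1 / a * (a * σ - 1) = 0 := by field_simp; ring
    rw [this, rpow_zero, mul_one]

theorem psi_phi {m : ℕ} {σ a : ℝ} (ha : 0 < a) {x : EuclideanSpace ℝ (Fin (m + 1))}
    (hx : 0 < x (Fin.last m)) : psiMap (m + 1) σ a (phiMap (m + 1) σ a x) = x := by
  ext i
  by_cases hi : i = Fin.last m
  · subst hi
    rw [psi_last, phi_last, ← rpow_mul hx.le, mul_one_div_cancel ha.ne', rpow_one]
  · rw [psi_ne _ _ _ hi, phi_last, phi_ne _ _ _ hi, ← rpow_mul hx.le, mul_assoc,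
      ← rpow_add hx]
    have : a * σ - 1 + a * (1 / a - σ) = 0 := by field_simp; ring
    rw [this, rpow_zero, mul_one]

theorem psi_mem {m : ℕ} {σ a : ℝ} (ha : 0 < a) {x : EuclideanSpace ℝ (Fin (m + 1))}
    (hx : x ∈ cuspDomain (m + 1) σ) : psiMap (m + 1) σ a x ∈ cuspDomain (m + 1) 1 := by
  rw [mem_cusp] at hx ⊢
  obtain ⟨h0, h1, h2⟩ := hx
  rw [psi_last]
  refine ⟨rpow_pos_of_pos h0 _, rpow_lt_one h0.le h1 (by positivity), fun i hi => ?_⟩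
  obtain ⟨h3, h4⟩ := h2 i hi
  rw [psi_ne _ _ _ hi]
  have hp := rpow_pos_of_pos h0 (1 / a - σ)
  refine ⟨mul_pos h3 hp, ?_⟩
  calc _ < x (Fin.last m) ^ σ * x (Fin.last m) ^ (1 / a - σ) := mul_lt_mul_of_pos_right h4 hp
    _ = _ := by rw [← rpow_add h0, rpow_one]; congr 1; ring

theorem phi_mem {m : ℕ} {σ a : ℝ} (ha : 0 < a) {x : EuclideanSpace ℝ (Fin (m + 1))}
    (hx : x ∈ cuspDomain (m + 1) 1) : phiMap (m + 1) σ a x ∈ cuspDomain (m + 1) σ := by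
  rw [mem_cusp] at hx ⊢
  obtain ⟨h0, h1, h2⟩ := hx
  rw [phi_last]
  refine ⟨rpow_pos_of_pos h0 _, rpow_lt_one h0.le h1 ha, fun i hi => ?_⟩
  obtain ⟨h3, h4⟩ := h2 i hi
  rw [phi_ne _ _ _ hi]
  have hp := rpow_pos_of_pos h0 (a * σ - 1)
  refine ⟨mul_pos h3 hp, ?_⟩
  calc _ < x (Fin.last m) ^ (1 : ℝ) * x (Fin.last m) ^ (a * σ - 1) :=
        mul_lt_mul_of_pos_right h4 hp
    _ = _ := by rw [← rpow_add h0, ← rpow_mul h0.le]; congr 1; ring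

theorem psi_image {m : ℕ} {σ a : ℝ} (ha : 0 < a) :
    psiMap (m + 1) σ a '' cuspDomain (m + 1) σ = cuspDomain (m + 1) 1 := by
  apply Set.Subset.antisymm
  · rintro _ ⟨x, hx, rfl⟩
    exact psi_mem ha hx
  · intro y hy
    exact ⟨_, phi_mem ha hy, psi_phi ha (mem_cusp.1 hy).1⟩

theorem measurable_cusp {m : ℕ} (σ : ℝ) : MeasurableSet (cuspDomain (m + 1) σ) := by
  have : cuspDomain (m + 1) σ = {x | 0 < x (Fin.last m)} ∩ ({x | x (Fin.last m) < 1} ∩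
      ⋂ i, {x | i ≠ Fin.last m → 0 < x i ∧ x i < x (Fin.last m) ^ σ}) := by
    ext x
    simp only [mem_cusp, Set.mem_inter_iff, Set.mem_setOf_eq, Set.mem_iInter]
  rw [this]
  have hm : ∀ i : Fin (m + 1), Measurable fun x : EuclideanSpace ℝ (Fin (m + 1)) => x i :=
    fun i => by fun_prop
  refine (measurableSet_lt measurable_const (hm _)).inter
    ((measurableSet_lt (hm _) measurable_const).inter (MeasurableSet.iInter fun i => ?_))
  by_cases hi : i = Fin.last m
  · simp [hi]
  · simp only [ne_eq, hi, not_false_eq_true, true_imp_iff]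
    exact (measurableSet_lt measurable_const (hm _)).inter
      (measurableSet_lt (hm _) ((hm _).pow_const _))

/-- The Jacobian matrix of `psiMap`. -/
def psiJac (m : ℕ) (σ a : ℝ) (x : EuclideanSpace ℝ (Fin (m + 1))) :
    Matrix (Fin (m + 1)) (Fin (m + 1)) ℝ := fun i j =>
  if i = Fin.last m then (if j = Fin.last m then (1 / a) * x (Fin.last m) ^ (1 / a - 1) else 0)
  else (if j = i then x (Fin.last m) ^ (1 / a - σ) else 0) +
    (if j = Fin.last m then x i * ((1 / a - σ) * x (Fin.last m) ^ (1 / a - σ - 1)) else 0)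

/-- The derivative of `psiMap`. -/
def psiD (m : ℕ) (σ a : ℝ) (x : EuclideanSpace ℝ (Fin (m + 1))) :
    EuclideanSpace ℝ (Fin (m + 1)) →L[ℝ] EuclideanSpace ℝ (Fin (m + 1)) :=
  LinearMap.toContinuousLinearMap (Matrix.toLpLin 2 2 (psiJac m σ a x))

theorem psiD_apply {m : ℕ} (σ a : ℝ) (x u : EuclideanSpace ℝ (Fin (m + 1))) (i : Fin (m + 1)) :
    psiD m σ a x u i = ∑ j, psiJac m σ a x i j * u j := rfl

theorem psi_hasFDerivAt {m : ℕ} {σ a : ℝ} {x : EuclideanSpace ℝ (Fin (m + 1))}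
    (hx : 0 < x (Fin.last m)) : HasFDerivAt (psiMap (m + 1) σ a) (psiD m σ a x) x := by
  rw [← hasFDerivWithinAt_univ, hasFDerivWithinAt_euclidean]
  intro i
  rw [hasFDerivWithinAt_univ]
  have hc : ∀ j : Fin (m + 1), HasFDerivAt (fun y : EuclideanSpace ℝ (Fin (m + 1)) => y j)
      (PiLp.proj 2 (fun _ : Fin (m + 1) => ℝ) j : EuclideanSpace ℝ (Fin (m + 1)) →L[ℝ] ℝ) x :=
    fun j => (PiLp.proj 2 (fun _ : Fin (m + 1) => ℝ) j :
      EuclideanSpace ℝ (Fin (m + 1)) →L[ℝ] ℝ).hasFDerivAt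
  by_cases hi : i = Fin.last m
  · subst hi
    simp only [psi_last]
    refine ((hc (Fin.last m)).rpow_const (p := 1 / a) (Or.inl hx.ne')).congr_fderiv ?_
    ext u
    change _ = psiD m σ a x u (Fin.last m)
    rw [psiD_apply]
    simp [psiJac]
  · simp only [psi_ne _ _ _ hi]
    refine ((hc i).mul ((hc (Fin.last m)).rpow_const (p := 1 / a - σ)
      (Or.inl hx.ne'))).congr_fderiv ?_
    ext u
    change _ = psiD m σ a x u i
    rw [psiD_apply]
    simp [psiJac, hi, add_mul, Finset.sum_add_distrib]
    ring

theorem psiD_det {m : ℕ} {σ a : ℝ} {x : EuclideanSpace ℝ (Fin (m + 1))} :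
    (psiD m σ a x).det = (x (Fin.last m) ^ (1 / a - σ)) ^ m *
      ((1 / a) * x (Fin.last m) ^ (1 / a - 1)) := by
  have h1 : (psiD m σ a x).det = (psiJac m σ a x).det := by
    rw [ContinuousLinearMap.det, psiD, LinearMap.coe_toContinuousLinearMap,
      Matrix.toLpLin_eq_toLin, LinearMap.det_toLin]
  rw [h1, Matrix.det_of_upperTriangular]
  · rw [Fin.prod_univ_castSucc]
    simp [psiJac, Fin.castSucc_ne_last]
  · intro i j hij
    have hij : j < i := hij
    have hj : j ≠ Fin.last m := fun h => by
      subst h; exact absurd hij (not_lt.2 (Fin.le_last _))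
    simp [psiJac, hj, hij.ne]

/-- For every `a > 0`, `q ≥ 1` and Borel measurable `v : Ω_n → [0,∞]`, the
change-of-variables identity `∫_{Ω_γ} v(ψ_a(x))^q w_{γ,a}(x) dx = ∫_{Ω_n} v(y)^q dy` holds. -/
theorem stmt_6 (n : ℕ) (hn : 2 ≤ n) (γ : ℝ) (hγ : (n : ℝ) < γ)
    (σ : ℝ) (hσ : σ = (γ - 1) / ((n : ℝ) - 1)) (a : ℝ) (ha : 0 < a)
    (q : ℝ) (hq : 1 ≤ q) (v : EuclideanSpace ℝ (Fin n) → ℝ≥0∞) (hv : Measurable v) :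
    ∫⁻ x in cuspDomain n σ, v (psiMap n σ a x) ^ q * ENNReal.ofReal (weightA n γ a x) =
      ∫⁻ y in simplexDomain n, v y ^ q := by
  obtain ⟨m, rfl⟩ : ∃ m, n = m + 1 := ⟨n - 1, by omega⟩
  have hinj : Set.InjOn (psiMap (m + 1) σ a) (cuspDomain (m + 1) σ) := fun x hx y hy h => by
    rw [← phi_psi (σ := σ) ha (mem_cusp.1 hx).1, h, phi_psi ha (mem_cusp.1 hy).1]
  rw [simplexDomain, ← psi_image (σ := σ) ha,
    lintegral_image_eq_lintegral_abs_det_fderiv_mul volume (measurable_cusp σ)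
      (fun x hx => (psi_hasFDerivAt (mem_cusp.1 hx).1).hasFDerivWithinAt) hinj]
  refine setLIntegral_congr_fun (measurable_cusp σ) fun x hx => ?_
  have h0 := (mem_cusp.1 hx).1
  have hdet : |(psiD m σ a x).det| = weightA (m + 1) γ a x := by
    rw [psiD_det, abs_of_pos (by positivity), weightA, lastCoord_succ, ← rpow_natCast,
      ← rpow_mul h0.le, mul_left_comm, ← rpow_add h0]
    congr 2
    have hm : (m : ℝ) ≠ 0 := by
      have : m ≠ 0 := by omega
      exact_mod_cast this
    rw [hσ]
    push_cast
    rw [add_sub_cancel_right]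
    field_simp
    ring
  simp only [hdet]
  rw [mul_comm]
end
end

section
/- Let v ∈ L^q(μ) satisfy ∫_X sgn(v(x))·|v(x)|^{q−1} dμ(x) = 0. Then for every t ∈ ℝ, ∫_X |v(x)|^q dμ(x) ≤ ∫_X |v(x) − t|^q dμ(x); that is, the function t ↦ ∫_X |v − t|^q dμ attains its minimum at t = 0. -/
open MeasureTheory Real Filter Topology

noncomputable section

/-- `sgnPow q s = sgn(s)·|s|^{q-1}`: equal to `|s|^{q-1}` if `s > 0`, to `-|s|^{q-1}` if
`s < 0`, and to `0` if `s = 0`. -/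
def sgnPow (q s : ℝ) : ℝ := Real.sign s * |s| ^ (q - 1)

lemma sgnPow_pointwise (q : ℝ) (hq : 1 < q) (s t : ℝ) :
    |s| ^ q - q * t * sgnPow q s ≤ |s - t| ^ q := by
  have hq0 : 0 < q := by linarith
  have ha := abs_nonneg s
  have hb := abs_nonneg (s - t)
  have hy : q * (|s| ^ (q - 1) * |s - t|) ≤ (q - 1) * |s| ^ q + |s - t| ^ q := by
    have h := Real.geom_mean_le_arith_mean2_weighted (w₁ := (q - 1) / q) (w₂ := 1 / q)
      (p₁ := |s| ^ q) (p₂ := |s - t| ^ q) (div_nonneg (by linarith) hq0.le)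
      (by positivity) (by positivity) (by positivity) (by field_simp; ring)
    rw [← Real.rpow_mul ha, ← Real.rpow_mul hb, mul_div_cancel₀ _ hq0.ne',
      mul_div_cancel₀ _ hq0.ne', Real.rpow_one] at h
    calc q * (|s| ^ (q - 1) * |s - t|)
        ≤ q * ((q - 1) / q * |s| ^ q + 1 / q * |s - t| ^ q) := by gcongr
      _ = _ := by field_simp
  have hp : 0 ≤ |s| ^ (q - 1) := by positivity
  have h1 : Real.sign s * (s - t) ≤ |s - t| := by
    rcases Real.sign_apply_eq s with h | h | h <;> rw [h]
    · linarith [neg_le_abs (s - t)]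
    · simp
    · linarith [le_abs_self (s - t)]
  have h2 : sgnPow q s * s = |s| ^ q := by
    unfold sgnPow
    rcases eq_or_ne s 0 with h | h
    · subst h; simp [Real.zero_rpow hq0.ne']
    · have hs : Real.sign s * s = |s| := by
        rcases lt_or_gt_of_ne h with h | h
        · rw [Real.sign_of_neg h, abs_of_neg h]; ring
        · rw [Real.sign_of_pos h, abs_of_pos h]; ring
      rw [mul_right_comm, hs, Real.rpow_sub_one (abs_ne_zero.mpr h)]
      field_simp
  have h3 : sgnPow q s * (s - t) ≤ |s| ^ (q - 1) * |s - t| := by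
    unfold sgnPow
    nlinarith [mul_le_mul_of_nonneg_left h1 hp]
  nlinarith [mul_le_mul_of_nonneg_left h3 hq0.le]

lemma measurable_sgnPow (q : ℝ) : Measurable (sgnPow q) := by
  have hs : Measurable Real.sign := by
    unfold Real.sign
    exact Measurable.ite measurableSet_Iio measurable_const
      (Measurable.ite measurableSet_Ioi measurable_const measurable_const)
  unfold sgnPow
  exact hs.mul (by fun_prop)

lemma abs_sgnPow_le (q : ℝ) (hq : 1 < q) (s : ℝ) : |sgnPow q s| ≤ |s| ^ q + 1 := by
  have hp : 0 ≤ |s| ^ (q - 1) := by positivity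
  have h1 : |sgnPow q s| ≤ |s| ^ (q - 1) := by
    unfold sgnPow
    rw [abs_mul, abs_of_nonneg hp]
    rcases Real.sign_apply_eq s with h | h | h <;> rw [h] <;> simp [hp]
  rcases le_total |s| 1 with h | h
  · have := Real.rpow_le_one (abs_nonneg s) h (by linarith : 0 ≤ q - 1)
    have : 0 ≤ |s| ^ q := by positivity
    linarith
  · have := Real.rpow_le_rpow_of_exponent_le h (by linarith : q - 1 ≤ q)
    linarith

lemma integrable_abs_rpow {X : Type*} [MeasurableSpace X] (μ : Measure X)
    (q : ℝ) (hq : 1 < q) (v : X → ℝ) (hv : MemLp v (ENNReal.ofReal q) μ) :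
    Integrable (fun x => |v x| ^ q) μ := by
  have h := hv.integrable_norm_rpow (by simp; linarith) ENNReal.ofReal_ne_top
  simpa [ENNReal.toReal_ofReal (by linarith : 0 ≤ q)] using h

/-- If `v ∈ L^q(μ)` satisfies `∫_X sgn(v)·|v|^{q-1} dμ = 0`, then for every
`t ∈ ℝ`, `∫_X |v|^q dμ ≤ ∫_X |v - t|^q dμ`; i.e. `t ↦ ∫_X |v - t|^q dμ` attains its minimum
at `t = 0`. -/
theorem stmt_12 {X : Type*} [MeasurableSpace X] (μ : Measure X) [IsFiniteMeasure μ]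
    (q : ℝ) (hq : 1 < q)
    (v : X → ℝ) (hv : MemLp v (ENNReal.ofReal q) μ)
    (hzero : ∫ x, sgnPow q (v x) ∂μ = 0) (t : ℝ) :
    ∫ x, |v x| ^ q ∂μ ≤ ∫ x, |v x - t| ^ q ∂μ := by
  have h1 := integrable_abs_rpow μ q hq v hv
  have h2 := integrable_abs_rpow μ q hq (fun x => v x - t) (hv.sub (memLp_const t))
  have h3 : Integrable (fun x => sgnPow q (v x)) μ := by
    refine (h1.add (integrable_const (1 : ℝ))).mono'
      ((measurable_sgnPow q).comp_aemeasurable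
        hv.aestronglyMeasurable.aemeasurable).aestronglyMeasurable ?_
    exact Eventually.of_forall fun x => abs_sgnPow_le q hq (v x)
  have h4 : ∫ x, (|v x| ^ q - q * t * sgnPow q (v x)) ∂μ ≤ ∫ x, |v x - t| ^ q ∂μ :=
    integral_mono (h1.sub (h3.const_mul _)) h2 fun x => sgnPow_pointwise q hq (v x) t
  rw [integral_sub h1 (h3.const_mul _), integral_const_mul, hzero] at h4
  simpa using h4
end
end

section
/- For every real a > 0, the map φ_a is a locally bi-Lipschitz homeomorphism of Ω_n onto Ω_γ: every point y ∈ Ω_n has an open neighborhood U ⊆ Ω_n such that φ_a restricted to U is Lipschitz with a Lipschitz inverse (given by ψ_a on φ_a(U)). -/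
open MeasureTheory Real Filter Topology
open scoped ENNReal

noncomputable section

/-- Common form of `phiMap` and `psiMap`. -/
def genMap (n : ℕ) (c d : ℝ) (y : EuclideanSpace ℝ (Fin n)) : EuclideanSpace ℝ (Fin n) :=
  WithLp.toLp 2 fun i => if (i : ℕ) + 1 = n then lastCoord y ^ c else y i * lastCoord y ^ d

lemma lastCoord_genMap {n : ℕ} (hn : 0 < n) (c d : ℝ) (y : EuclideanSpace ℝ (Fin n)) :
    lastCoord (genMap n c d y) = lastCoord y ^ c := by
  have h : n - 1 + 1 = n := by omega
  rw [lastCoord, dif_pos hn]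
  simp [genMap, h]

lemma lastCoord_eq {n : ℕ} (y : EuclideanSpace ℝ (Fin n)) (i : Fin n) (hi : (i : ℕ) + 1 = n) :
    lastCoord y = y i := by
  have hn : 0 < n := by omega
  rw [lastCoord, dif_pos hn]
  have : (⟨n - 1, Nat.sub_lt hn Nat.one_pos⟩ : Fin n) = i := Fin.ext (by simp only; omega)
  rw [this]

lemma contDiff_lastCoord {n : ℕ} :
    ContDiff ℝ 1 (fun y : EuclideanSpace ℝ (Fin n) => lastCoord y) := by
  unfold lastCoord
  split_ifs <;> fun_prop

lemma contDiffAt_genMap {n : ℕ} (c d : ℝ) (y : EuclideanSpace ℝ (Fin n))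
    (hy : 0 < lastCoord y) : ContDiffAt ℝ 1 (genMap n c d) y := by
  rw [contDiffAt_euclidean]
  intro i
  have h (e : ℝ) : ContDiffAt ℝ 1 (fun y : EuclideanSpace ℝ (Fin n) => lastCoord y ^ e) y :=
    contDiff_lastCoord.contDiffAt.rpow_const_of_ne hy.ne'
  by_cases hi : (i : ℕ) + 1 = n
  · simpa [genMap, hi] using h c
  · simp only [genMap, hi, if_false]
    exact ContDiffAt.mul (by fun_prop) (h d)

lemma genMap_genMap {n : ℕ} (hn : 0 < n) {c d c' d' : ℝ} (hc : c * c' = 1) (hd : d + c * d' = 0)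
    (y : EuclideanSpace ℝ (Fin n)) (hy : 0 < lastCoord y) :
    genMap n c' d' (genMap n c d y) = y := by
  ext i
  have e : genMap n c' d' (genMap n c d y) i = if (i : ℕ) + 1 = n then
    lastCoord (genMap n c d y) ^ c' else genMap n c d y i * lastCoord (genMap n c d y) ^ d' := rfl
  rw [e, lastCoord_genMap hn]
  by_cases hi : (i : ℕ) + 1 = n
  · rw [if_pos hi, ← Real.rpow_mul hy.le, hc, Real.rpow_one, lastCoord_eq y i hi]
  · have e2 : genMap n c d y i = y i * lastCoord y ^ d := by simp [genMap, hi]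
    rw [if_neg hi, e2, ← Real.rpow_mul hy.le, mul_assoc, ← Real.rpow_add hy, hd, Real.rpow_zero,
      mul_one]

lemma genMap_mapsTo {n : ℕ} (hn : 0 < n) {c d s t : ℝ} (hc : 0 < c) (h : s + d = c * t) :
    Set.MapsTo (genMap n c d) (cuspDomain n s) (cuspDomain n t) := by
  rintro y ⟨h0, h1, h2⟩
  refine ⟨?_, ?_, fun i hi => ?_⟩
  · rw [lastCoord_genMap hn]; positivity
  · rw [lastCoord_genMap hn]; exact Real.rpow_lt_one h0.le h1 hc
  · have e2 : genMap n c d y i = y i * lastCoord y ^ d := by simp [genMap, hi]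
    obtain ⟨h3, h4⟩ := h2 i hi
    have hp : 0 < lastCoord y ^ d := by positivity
    rw [lastCoord_genMap hn, e2, ← Real.rpow_mul h0.le, ← h, Real.rpow_add h0]
    exact ⟨by positivity, mul_lt_mul_of_pos_right h4 hp⟩

lemma isOpen_simplexDomain (n : ℕ) : IsOpen (simplexDomain n) := by
  have hl : Continuous (fun y : EuclideanSpace ℝ (Fin n) => lastCoord y) :=
    contDiff_lastCoord.continuous
  have : simplexDomain n = {y | 0 < lastCoord y} ∩ ({y | lastCoord y < 1} ∩
      ⋂ i : Fin n, {y | (i : ℕ) + 1 ≠ n → 0 < y i ∧ y i < lastCoord y}) := by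
    ext y
    simp [simplexDomain, cuspDomain]
  rw [this]
  refine (isOpen_lt continuous_const hl).inter ((isOpen_lt hl continuous_const).inter
    (isOpen_iInter_of_finite fun i => ?_))
  by_cases hi : (i : ℕ) + 1 = n
  · simp [hi]
  · simp only [ne_eq, hi, not_false_eq_true, forall_const]
    have hi' : Continuous (fun y : EuclideanSpace ℝ (Fin n) => y i) := by fun_prop
    exact (isOpen_lt continuous_const hi').inter (isOpen_lt hi' hl)

/-- For every `a > 0`, `φ_a` is a locally bi-Lipschitz homeomorphism of `Ω_n`
onto `Ω_γ`: it maps `Ω_n` bijectively onto `Ω_γ`, and every `y ∈ Ω_n` has an open neighborhood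
`U ⊆ Ω_n` on which `φ_a` is Lipschitz with Lipschitz inverse given by `ψ_a` on `φ_a(U)`. -/
theorem stmt_15 (n : ℕ) (hn : 2 ≤ n) (γ : ℝ) (hγ : (n : ℝ) < γ)
    (σ : ℝ) (hσ : σ = (γ - 1) / ((n : ℝ) - 1)) (a : ℝ) (ha : 0 < a) :
    Set.BijOn (phiMap n σ a) (simplexDomain n) (cuspDomain n σ) ∧
    ∀ y ∈ simplexDomain n, ∃ U : Set (EuclideanSpace ℝ (Fin n)),
      IsOpen U ∧ y ∈ U ∧ U ⊆ simplexDomain n ∧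
      ∃ K K' : NNReal,
        LipschitzOnWith K (phiMap n σ a) U ∧
        LipschitzOnWith K' (psiMap n σ a) (phiMap n σ a '' U) ∧
        ∀ z ∈ U, psiMap n σ a (phiMap n σ a z) = z := by
  have hn0 : 0 < n := by omega
  have ha' : a ≠ 0 := ha.ne'
  have hphi : phiMap n σ a = genMap n a (a * σ - 1) := rfl
  have hpsi : psiMap n σ a = genMap n (1 / a) (1 / a - σ) := rfl
  rw [hphi, hpsi]
  have hleft : ∀ y : EuclideanSpace ℝ (Fin n), 0 < lastCoord y →
      genMap n (1 / a) (1 / a - σ) (genMap n a (a * σ - 1) y) = y :=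
    genMap_genMap hn0 (by field_simp) (by field_simp; ring)
  have hright : ∀ y : EuclideanSpace ℝ (Fin n), 0 < lastCoord y →
      genMap n a (a * σ - 1) (genMap n (1 / a) (1 / a - σ) y) = y :=
    genMap_genMap hn0 (by field_simp) (by field_simp; ring)
  refine ⟨?_, fun y hy => ?_⟩
  · refine Set.InvOn.bijOn (f' := genMap n (1 / a) (1 / a - σ))
      ⟨fun y hy => hleft y hy.1, fun y hy => hright y hy.1⟩ ?_ ?_
    · exact genMap_mapsTo hn0 ha (by ring)
    · exact genMap_mapsTo hn0 (by positivity) (by ring)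
  · have hy0 : 0 < lastCoord y := hy.1
    have hc := contDiffAt_genMap a (a * σ - 1) y hy0
    obtain ⟨K, s, hs, hK⟩ := hc.exists_lipschitzOnWith
    have hz : 0 < lastCoord (genMap n a (a * σ - 1) y) := by
      rw [lastCoord_genMap hn0]; positivity
    obtain ⟨K', t, ht, hK'⟩ :=
      (contDiffAt_genMap (1 / a) (1 / a - σ) _ hz).exists_lipschitzOnWith
    have hmem := Filter.inter_mem (Filter.inter_mem hs (hc.continuousAt ht))
      ((isOpen_simplexDomain n).mem_nhds hy)
    obtain ⟨U, hU, hUo, hyU⟩ := mem_nhds_iff.1 hmem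
    refine ⟨U, hUo, hyU, fun z hz => (hU hz).2, K, K', hK.mono fun z hz => (hU hz).1.1,
      hK'.mono ?_, fun z hz => hleft z (hU hz).2.1⟩
    rintro _ ⟨z, hz, rfl⟩
    exact (hU hz).1.2
end
end
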